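/- arXiv:0903.5143 — 2 statements merged into one kernel-verified Lean document; each statement's English description precedes it below -/
import Mathlib

section
/- Let n and d be positive integers with d ≥ n. Then the unitary Gram matrix G_n^{U(d)}, indexed by S_n with entries G(σ,τ) = d^{c(σ⁻¹τ)}, is invertible, and for any σ, τ ∈ S_n such that σ⁻¹τ is an n-cycle, the corresponding entry of its inverse is (G_n^{U(d)})⁻¹(σ,τ) = (−1)^{n−1} · C_{n−1} · ∏_{j=−(n−1)}^{n−1} (d − j)⁻¹, where C_{n−1} = (2n−2)!/(n!·(n−1)!) is the (n−1)-st Catalan number. -/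
/-- number of orbits (cycles together with fixed points) of a permutation of `Fin N`. -/
def cycleCount {N : ℕ} (σ : Equiv.Perm (Fin N)) : ℕ :=
  σ.cycleType.card + (Finset.univ.filter fun x => σ x = x).card

/-- The unitary Gram matrix `G_n^{U(d)}`. -/
noncomputable def GramU (d n : ℕ) :
    Matrix (Equiv.Perm (Fin n)) (Equiv.Perm (Fin n)) ℝ :=
  fun σ τ => (d : ℝ) ^ cycleCount (σ⁻¹ * τ)

section GramMatrix

open Equiv Finset

theorem cycleCount_add_sum {N : ℕ} (σ : Perm (Fin N)) :
    cycleCount σ + σ.cycleType.sum = σ.cycleType.card + N := by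
  have h := Finset.card_filter_add_card_filter_not (s := (univ : Finset (Fin N))) (fun x => σ x = x)
  rw [Perm.sum_cycleType, Perm.support]
  simp only [cycleCount, Finset.card_univ, Fintype.card_fin, ne_eq] at *
  omega

theorem cycleCount_congr {N : ℕ} {σ τ : Perm (Fin N)} (h : σ.cycleType = τ.cycleType) :
    cycleCount σ = cycleCount τ := by
  have h1 := cycleCount_add_sum σ
  have h2 := cycleCount_add_sum τ
  rw [h] at h1
  omega

theorem cycleCount_conj {N : ℕ} (σ τ : Perm (Fin N)) :
    cycleCount (τ * σ * τ⁻¹) = cycleCount σ :=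
  cycleCount_congr Perm.cycleType_conj

theorem cycleCount_inv {N : ℕ} (σ : Perm (Fin N)) : cycleCount σ⁻¹ = cycleCount σ :=
  cycleCount_congr (Perm.cycleType_inv σ)

theorem cycleCount_mul_comm {N : ℕ} (σ τ : Perm (Fin N)) :
    cycleCount (σ * τ) = cycleCount (τ * σ) := by
  rw [← cycleCount_conj (σ * τ) τ]
  congr 1
  group

theorem cycleCount_one {N : ℕ} : cycleCount (1 : Perm (Fin N)) = N := by
  simp [cycleCount]

/-- Splitting a fixed point off a cycle creates one new cycle. -/
theorem cycleCount_swap_apply_mul {N : ℕ} {g : Perm (Fin N)} {a : Fin N} (ha : g a ≠ a) :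
    cycleCount (swap a (g a) * g) = cycleCount g + 1 := by
  set c := g.cycleOf a with hc
  have hca : c a = g a := Perm.cycleOf_apply_self g a
  have hcyc : c.IsCycle := Perm.isCycle_cycleOf g ha
  have hdis : (g * c⁻¹).Disjoint c := Perm.disjoint_mul_inv_of_mem_cycleFactorsFinset
    (Perm.cycleOf_mem_cycleFactorsFinset_iff.2 (Perm.mem_support.2 ha))
  set h := g * c⁻¹ with hh
  have hg : g = c * h := by
    rw [← hdis.commute.eq, hh, inv_mul_cancel_right]
  have hgt : g.cycleType = c.cycleType + h.cycleType := by
    rw [hg, hdis.symm.cycleType_mul]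
  have h1 := cycleCount_add_sum g
  have h2 := cycleCount_add_sum (swap a (g a) * g)
  rw [hgt, hcyc.cycleType] at h1
  have hcard : 2 ≤ c.support.card := hcyc.two_le_card_support
  by_cases h' : c (c a) = a
  · have hcs := hcyc.eq_swap_of_apply_apply_eq_self (hca ▸ ha) h'
    have : swap a (g a) * g = h := by
      nth_rewrite 2 [hg]
      rw [hcs, hca, ← mul_assoc, swap_mul_self, one_mul]
    rw [this] at h2 ⊢
    have hc2 : c.support.card = 2 := by
      rw [hcs]; exact Perm.card_support_swap (hca ▸ ha.symm)
    rw [hc2] at h1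
    simp at h1
    omega
  · have hs : (swap a (c a) * c).support = c.support \ {a} := Perm.support_swap_mul_eq c a h'
    have hcyc' := hcyc.swap_mul (hca ▸ ha) h'
    have hdis' : (swap a (c a) * c).Disjoint h := by
      rw [Perm.disjoint_iff_disjoint_support] at hdis ⊢
      rw [hs]
      exact hdis.symm.mono_left sdiff_subset
    have : swap a (g a) * g = (swap a (c a) * c) * h := by
      rw [mul_assoc, ← hg, hca]
    rw [this] at h2 ⊢
    rw [hdis'.cycleType_mul, hcyc'.cycleType, hs] at h2
    have : (c.support \ {a}).card + 1 = c.support.card := by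
      rw [sdiff_singleton_eq_erase]
      exact card_erase_add_one (Perm.mem_support.2 (hca ▸ ha))
    simp at h1 h2
    omega

theorem cycleCount_swap_mul {N : ℕ} {g : Perm (Fin N)} {a x : Fin N} (ha : g a = a) (hx : x ≠ a) :
    cycleCount (swap a x * g) + 1 = cycleCount g := by
  have h1 : (swap a x * g) a = x := by simp [ha]
  have := cycleCount_swap_apply_mul (g := swap a x * g) (a := a) (by rw [h1]; exact hx)
  rw [h1, ← mul_assoc, swap_mul_self, one_mul] at this
  exact this.symm

theorem cycleType_eq_of_cycleCount_eq_one {N : ℕ} {σ τ : Perm (Fin N)} (hσ : cycleCount σ = 1)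
    (hτ : cycleCount τ = 1) : σ.cycleType = τ.cycleType := by
  have key : ∀ ρ : Perm (Fin N), cycleCount ρ = 1 →
      (ρ = 1 ∧ N = 1) ∨ (ρ.cycleType = {N}) := by
    intro ρ hρ
    have h := cycleCount_add_sum ρ
    have hle : ρ.cycleType.card ≤ 1 := by rw [← hρ]; exact Nat.le_add_right _ _
    rcases Nat.le_one_iff_eq_zero_or_eq_one.1 hle with h0 | h0
    · rw [Multiset.card_eq_zero] at h0
      rw [h0, hρ] at h
      left
      exact ⟨Perm.cycleType_eq_zero.1 h0, by simpa using h.symm⟩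
    · obtain ⟨m, hm⟩ := Multiset.card_eq_one.1 h0
      rw [hm, hρ] at h
      right
      rw [hm]
      simp at h
      rw [h]
  rcases key σ hσ with ⟨h1, h2⟩ | h1
  · subst h2
    rw [Subsingleton.elim σ τ]
  · rcases key τ hτ with ⟨h3, h4⟩ | h3
    · subst h4
      rw [Subsingleton.elim σ τ]
    · rw [h1, h3]

theorem cycleCount_eq_one_of_forall_sameCycle {N : ℕ} {σ : Perm (Fin N)} {p : Fin N}
    (h : ∀ z, σ.SameCycle p z) : cycleCount σ = 1 := by
  by_cases hp : σ p = p
  · have hz : ∀ z, z = p := fun z => by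
      obtain ⟨k, hk⟩ := h z
      rw [← hk, Perm.zpow_apply_eq_self_of_apply_eq_self hp]
    have : N = 1 := by
      have := Fintype.card_eq_one_iff.2 ⟨p, hz⟩
      simpa using this
    subst this
    rw [Subsingleton.elim σ 1, cycleCount_one]
  · have hc : σ.IsCycle := ⟨p, hp, fun y _ => h y⟩
    have hs : (univ.filter fun x => σ x = x) = ∅ := by
      rw [filter_eq_empty_iff]
      intro x _ hx
      exact hp (((h x).apply_eq_self_iff).2 hx)
    simp [cycleCount, hc.cycleType, hs]

theorem mem_permsOfFinset {N : ℕ} {s : Finset (Fin N)} {σ : Perm (Fin N)} :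
    σ ∈ permsOfFinset s ↔ ∀ x ∉ s, σ x = x := by
  rw [mem_perms_of_finset_iff]
  exact ⟨fun h x hx => by_contra fun h' => hx (h h'), fun h x hx => by_contra fun h' => hx (h x h')⟩

theorem apply_mem_of_mem_permsOfFinset {N : ℕ} {s : Finset (Fin N)} {σ : Perm (Fin N)}
    (h : σ ∈ permsOfFinset s) {x : Fin N} (hx : x ∈ s) : σ x ∈ s := by
  rw [mem_permsOfFinset] at h
  by_contra h'
  have := σ.injective (h _ h')
  rw [this] at h'
  exact h' hx

theorem mul_mem_permsOfFinset {N : ℕ} {s : Finset (Fin N)} {σ τ : Perm (Fin N)}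
    (h : σ ∈ permsOfFinset s) (h' : τ ∈ permsOfFinset s) : σ * τ ∈ permsOfFinset s := by
  rw [mem_permsOfFinset] at *
  intro x hx
  rw [Perm.mul_apply, h' x hx, h x hx]

theorem inv_mem_permsOfFinset {N : ℕ} {s : Finset (Fin N)} {σ : Perm (Fin N)}
    (h : σ ∈ permsOfFinset s) : σ⁻¹ ∈ permsOfFinset s := by
  rw [mem_permsOfFinset] at *
  intro x hx
  rw [Perm.inv_eq_iff_eq, h x hx]

theorem swap_mem_permsOfFinset {N : ℕ} {s : Finset (Fin N)} {a b : Fin N}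
    (ha : a ∈ s) (hb : b ∈ s) : swap a b ∈ permsOfFinset s := by
  rw [mem_permsOfFinset]
  intro x hx
  exact swap_apply_of_ne_of_ne (fun h => hx (h ▸ ha)) (fun h => hx (h ▸ hb))

theorem permsOfFinset_mono {N : ℕ} {s t : Finset (Fin N)} (h : s ⊆ t) :
    permsOfFinset s ⊆ permsOfFinset t := by
  intro σ hσ
  rw [mem_permsOfFinset] at *
  exact fun x hx => hσ x fun h' => hx (h h')

/-- Coset decomposition of the permutations of `insert a s` over those of `s`. -/
theorem sum_permsOfFinset_insert {N : ℕ} {M : Type*} [AddCommMonoid M] {s : Finset (Fin N)}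
    {a : Fin N} (ha : a ∉ s) (F : Perm (Fin N) → M) :
    ∑ σ ∈ permsOfFinset (insert a s), F σ =
      ∑ σ ∈ permsOfFinset s, F σ + ∑ x ∈ s, ∑ σ ∈ permsOfFinset s, F (swap a x * σ) := by
  have : ∑ σ ∈ permsOfFinset s, F σ = ∑ σ ∈ permsOfFinset s, F (swap a a * σ) := by
    simp only [swap_self]; rfl
  rw [this, ← Finset.sum_insert (f := fun x => ∑ σ ∈ permsOfFinset s, F (swap a x * σ)) ha,
    ← Finset.sum_product']
  symm
  refine Finset.sum_bij' (fun t _ => swap a t.1 * t.2) (fun σ _ => (σ a, swap a (σ a) * σ))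
    ?_ ?_ ?_ ?_ ?_
  · rintro ⟨x, σ⟩ h
    rw [mem_product] at h
    exact mul_mem_permsOfFinset (swap_mem_permsOfFinset (mem_insert_self _ _) h.1)
      (permsOfFinset_mono (subset_insert _ _) h.2)
  · intro σ h
    have hσa := apply_mem_of_mem_permsOfFinset h (mem_insert_self a s)
    refine mem_product.2 ⟨hσa, ?_⟩
    rw [mem_permsOfFinset]
    intro x hx
    by_cases hxa : x = a
    · simp [hxa]
    · exact mem_permsOfFinset.1 (mul_mem_permsOfFinset
        (swap_mem_permsOfFinset (mem_insert_self _ _) hσa) h) x (by simp [hx, hxa])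
  · rintro ⟨x, σ⟩ h
    rw [mem_product] at h
    have : σ a = a := mem_permsOfFinset.1 h.2 a ha
    simp [this, ← mul_assoc]
  · intro σ h
    simp [← mul_assoc]
  · intros
    rfl

theorem sum_permsOfFinset_insert' {N : ℕ} {M : Type*} [AddCommMonoid M] {s : Finset (Fin N)}
    {a : Fin N} (ha : a ∉ s) (F : Perm (Fin N) → M) :
    ∑ σ ∈ permsOfFinset (insert a s), F σ =
      ∑ σ ∈ permsOfFinset s, F σ + ∑ x ∈ s, ∑ σ ∈ permsOfFinset s, F (σ * swap a x) := by
  have key : ∀ (t : Finset (Fin N)) (H : Perm (Fin N) → M),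
      ∑ σ ∈ permsOfFinset t, H σ = ∑ σ ∈ permsOfFinset t, H σ⁻¹ := fun t H =>
    Finset.sum_bij' (fun σ _ => σ⁻¹) (fun σ _ => σ⁻¹) (fun _ h => inv_mem_permsOfFinset h)
      (fun _ h => inv_mem_permsOfFinset h) (by simp) (by simp) (by simp)
  rw [key, sum_permsOfFinset_insert ha, key s F]
  congr 1
  refine Finset.sum_congr rfl fun x _ => ?_
  rw [key s (fun σ => F (σ * swap a x))]
  simp

theorem permsOfFinset_empty {N : ℕ} : permsOfFinset (∅ : Finset (Fin N)) = {1} := by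
  ext σ
  rw [mem_permsOfFinset, mem_singleton]
  exact ⟨fun h => Equiv.ext fun x => h x (notMem_empty x), fun h x _ => by simp [h]⟩

theorem permsOfFinset_singleton {N : ℕ} (p : Fin N) : permsOfFinset {p} = {1} := by
  ext σ
  rw [mem_permsOfFinset, mem_singleton]
  refine ⟨fun h => ?_, fun h x _ => by simp [h]⟩
  have h' : ∀ x ≠ p, σ x = x := fun x hx => h x (by simpa using hx)
  refine Equiv.ext fun x => ?_
  by_cases hx : x = p
  · by_contra hne
    have h1 : σ x ≠ p := fun h2 => hne (by rw [h2, hx]; rfl)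
    exact hne (σ.injective (h' _ h1))
  · exact h' x hx

/-- The signed sum over row permutations `r` of `s` and column permutations `q` of `t`; for
`s ∩ t = {p}` this is evaluation at the Young symmetrizer of a hook with corner `p`. -/
noncomputable def hookSum {N : ℕ} {R : Type*} [Ring R] (s t : Finset (Fin N))
    (F : Perm (Fin N) → R) : R :=
  ∑ r ∈ permsOfFinset s, ∑ q ∈ permsOfFinset t, ((Perm.sign q : ℤ) : R) * F (r * q)

theorem hookSum_insert_left {N : ℕ} {R : Type*} [CommRing R] {a : Fin N}
    {s t : Finset (Fin N)} (has : a ∉ s) (hat : a ∉ t) (X : R) :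
    X * hookSum (insert a s) t (fun σ => X ^ cycleCount σ) =
      (X + (s.card : R)) * hookSum s t (fun σ => X ^ cycleCount σ) := by
  have key : ∀ x ∈ s, X * ∑ r ∈ permsOfFinset s, ∑ q ∈ permsOfFinset t,
      ((Perm.sign q : ℤ) : R) * X ^ cycleCount (swap a x * r * q) =
      hookSum s t (fun σ => X ^ cycleCount σ) := by
    intro x hx
    simp only [hookSum, mul_sum]
    refine sum_congr rfl fun r hr => sum_congr rfl fun q hq => ?_
    have hfix : (r * q) a = a := by
      rw [Perm.mul_apply, mem_permsOfFinset.1 hq a hat, mem_permsOfFinset.1 hr a has]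
    rw [← cycleCount_swap_mul hfix (fun h => has (h ▸ hx)), mul_assoc, pow_succ]
    ring
  rw [hookSum, sum_permsOfFinset_insert has, mul_add, mul_sum s, sum_congr rfl key, sum_const,
    nsmul_eq_mul, add_mul]
  rfl

theorem hookSum_insert_right {N : ℕ} {R : Type*} [CommRing R] {a : Fin N}
    {s t : Finset (Fin N)} (has : a ∉ s) (hat : a ∉ t) (X : R) :
    X * hookSum s (insert a t) (fun σ => X ^ cycleCount σ) =
      (X - (t.card : R)) * hookSum s t (fun σ => X ^ cycleCount σ) := by
  have key : ∀ x ∈ t, X * ∑ r ∈ permsOfFinset s, ∑ q ∈ permsOfFinset t,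
      ((Perm.sign (q * swap a x) : ℤ) : R) * X ^ cycleCount (r * (q * swap a x)) =
      - hookSum s t (fun σ => X ^ cycleCount σ) := by
    intro x hx
    simp only [hookSum, mul_sum, ← sum_neg_distrib]
    refine sum_congr rfl fun r hr => sum_congr rfl fun q hq => ?_
    have hfix : (r * q) a = a := by
      rw [Perm.mul_apply, mem_permsOfFinset.1 hq a hat, mem_permsOfFinset.1 hr a has]
    have hxa : x ≠ a := fun h => hat (h ▸ hx)
    rw [← cycleCount_swap_mul hfix hxa, ← mul_assoc r q, cycleCount_mul_comm _ (swap a x), pow_succ,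
      Perm.sign_mul, Perm.sign_swap hxa.symm]
    push_cast
    ring
  have hsplit : hookSum s (insert a t) (fun σ => X ^ cycleCount σ) =
      hookSum s t (fun σ => X ^ cycleCount σ) + ∑ x ∈ t, ∑ r ∈ permsOfFinset s,
        ∑ q ∈ permsOfFinset t, ((Perm.sign (q * swap a x) : ℤ) : R) *
          X ^ cycleCount (r * (q * swap a x)) := by
    rw [sum_comm, hookSum, hookSum, ← sum_add_distrib]
    exact sum_congr rfl fun r _ => sum_permsOfFinset_insert' hat _
  rw [hsplit, mul_add, mul_sum t, sum_congr rfl key, sum_const, nsmul_eq_mul]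
  ring

theorem hookSum_cycleCount {N : ℕ} {R : Type*} [CommRing R] {p : Fin N} {X : R}
    (C : Finset (Fin N)) (hp : p ∉ C) :
    ∀ A : Finset (Fin N), p ∉ A → Disjoint A C →
      X ^ (A.card + C.card) * hookSum (insert p A) (insert p C) (fun σ => X ^ cycleCount σ) =
        X ^ N * (∏ j ∈ range A.card, (X + (j + 1 : ℕ))) *
          ∏ j ∈ range C.card, (X - (j + 1 : ℕ)) := by
  intro A
  induction A using Finset.induction_on with
  | empty =>
    intro _ _
    induction C using Finset.induction_on with
    | empty => simp [hookSum, permsOfFinset_singleton, cycleCount_one]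
    | insert a C ha ih =>
      rw [mem_insert, not_or] at hp
      have ih := ih hp.2 (disjoint_empty_left C)
      have hstep := hookSum_insert_right (s := insert p ∅) (t := insert p C) (a := a)
        (by simpa using Ne.symm hp.1) (by simpa [ha] using Ne.symm hp.1) X
      rw [card_insert_of_notMem hp.2] at hstep
      rw [card_insert_of_notMem ha, prod_range_succ, Finset.insert_comm p a C, ← mul_assoc, ← ih,
        ← add_assoc, pow_succ, mul_assoc, hstep]
      ring
  | insert a A ha ih =>
    intro hpA hd
    rw [mem_insert, not_or] at hpA
    rw [disjoint_insert_left] at hd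
    have ih := ih hpA.2 hd.2
    have hstep := hookSum_insert_left (s := insert p A) (t := insert p C) (a := a)
      (by simpa [ha] using Ne.symm hpA.1) (by simpa [hd.1] using Ne.symm hpA.1) X
    rw [card_insert_of_notMem hpA.2] at hstep
    rw [card_insert_of_notMem ha, prod_range_succ, Finset.insert_comm p a A, add_right_comm, pow_succ,
      mul_assoc, hstep, mul_left_comm, ih]
    ring

theorem neg_one_pow_card_sameCycle {N : ℕ} (σ : Perm (Fin N)) (z : Fin N) :
    (-1 : ℝ) ^ (univ.filter fun y => σ.SameCycle z y).card =
      -((Perm.sign (σ.cycleOf z) : ℤ) : ℝ) := by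
  by_cases hz : σ z = z
  · have h1 : (univ.filter fun y => σ.SameCycle z y) = {z} := by
      ext y
      simp only [mem_filter, mem_univ, true_and, mem_singleton]
      constructor
      · rintro ⟨k, rfl⟩
        exact Perm.zpow_apply_eq_self_of_apply_eq_self hz k
      · rintro rfl
        exact Perm.SameCycle.refl _ _
    rw [h1, (Perm.cycleOf_eq_one_iff σ).2 hz]
    simp
  · have h1 : (univ.filter fun y => σ.SameCycle z y) = (σ.cycleOf z).support := by
      ext y
      simp [Perm.mem_support_cycleOf_iff' hz]
    rw [h1, (Perm.isCycle_cycleOf σ hz).sign]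
    push_cast
    ring

theorem apply_eq_of_not_mem {N : ℕ} {σ r : Perm (Fin N)} {p z : Fin N} {C : Finset (Fin N)}
    (hr : r ∈ permsOfFinset Cᶜ) (hq : r⁻¹ * σ ∈ permsOfFinset (insert p C))
    (hz : ¬ σ.SameCycle p z) (hzC : z ∉ C) {y : Fin N} (hy : σ.SameCycle z y) :
    y ∉ C ∧ σ y = r y := by
  have hstep : ∀ y, σ.SameCycle z y → y ∉ C → σ y = r y := by
    intro y hy hyC
    have hyp : y ≠ p := fun h => hz (h ▸ hy.symm)
    have := mem_permsOfFinset.1 hq y (by simp [hyp, hyC])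
    rwa [Perm.mul_apply, Perm.inv_eq_iff_eq] at this
  have hpow : ∀ k : ℕ, (σ ^ k) z ∉ C := by
    intro k
    induction k with
    | zero => simpa using hzC
    | succ k ih =>
      rw [pow_succ', Perm.mul_apply, hstep _ ⟨k, by simp⟩ ih]
      exact mem_compl.1 (apply_mem_of_mem_permsOfFinset hr (mem_compl.2 ih))
  obtain ⟨k, hk⟩ := hy.exists_nat_pow_eq
  have hyC : y ∉ C := hk ▸ hpow k
  exact ⟨hyC, hstep y hy hyC⟩

theorem apply_eq_of_mem {N : ℕ} {σ r : Perm (Fin N)} {p z : Fin N} {C : Finset (Fin N)}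
    (hp : p ∉ C)
    (hr : r ∈ permsOfFinset Cᶜ) (hq : r⁻¹ * σ ∈ permsOfFinset (insert p C))
    (hz : ¬ σ.SameCycle p z) (hzC : z ∈ C) {y : Fin N} (hy : σ.SameCycle z y) :
    y ∈ C ∧ (r⁻¹ * σ) y = σ y := by
  have hmem : ∀ y, σ.SameCycle z y → y ∈ C := by
    intro y hy
    by_contra hyC
    exact (apply_eq_of_not_mem hr hq (fun h => hz (h.trans hy.symm)) hyC hy.symm).1 hzC
  refine ⟨hmem y hy, ?_⟩
  have h1 := apply_mem_of_mem_permsOfFinset hq (mem_insert_of_mem (hmem y hy))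
  have h2 : r ((r⁻¹ * σ) y) = σ y := by simp
  rcases mem_insert.1 h1 with h | h
  · exfalso
    rw [h] at h2
    have h3 := apply_mem_of_mem_permsOfFinset hr (mem_compl.2 hp)
    rw [h2] at h3
    exact mem_compl.1 h3 (hmem _ ⟨1 + hy.choose, by rw [zpow_add, Perm.mul_apply, hy.choose_spec]; simp⟩)
  · rw [← h2, mem_permsOfFinset.1 hr _ (by simpa using h)]

theorem sum_factorizations_eq_zero {N : ℕ} {σ : Perm (Fin N)} {p z : Fin N}
    (hz : ¬ σ.SameCycle p z) :
    ∑ t ∈ (univ : Finset (Finset (Fin N) × Perm (Fin N))).filter (fun t => p ∉ t.1 ∧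
      t.2 ∈ permsOfFinset t.1ᶜ ∧ t.2⁻¹ * σ ∈ permsOfFinset (insert p t.1)),
      (-1 : ℝ) ^ t.1.card * ((Perm.sign (t.2⁻¹ * σ) : ℤ) : ℝ) = 0 := by
  set D := univ.filter fun y => σ.SameCycle z y with hD
  set δ := σ.cycleOf z with hδ
  have hDmem : ∀ y, y ∈ D ↔ σ.SameCycle z y := by simp [hD]
  have hzD : z ∈ D := (hDmem z).2 (Perm.SameCycle.refl _ _)
  have hpD : p ∉ D := fun h => hz ((hDmem p).1 h).symm
  have hδ1 : ∀ y ∈ D, δ y = σ y := fun y hy => ((hDmem y).1 hy).cycleOf_apply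
  have hδ2 : ∀ y ∉ D, δ y = y := fun y hy =>
    Perm.cycleOf_apply_of_not_sameCycle fun h => hy ((hDmem y).2 h)
  have hδp : δ ∈ permsOfFinset D := mem_permsOfFinset.2 hδ2
  have hδi : δ⁻¹ ∈ permsOfFinset D := inv_mem_permsOfFinset hδp
  have hsign : (-1 : ℝ) ^ D.card = -((Perm.sign δ : ℤ) : ℝ) := neg_one_pow_card_sameCycle σ z
  have hout : ∀ (C : Finset (Fin N)) (r : Perm (Fin N)), p ∉ C → r ∈ permsOfFinset Cᶜ →
      r⁻¹ * σ ∈ permsOfFinset (insert p C) → z ∉ C → Disjoint C D := by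
    intro C r hp hr hq hzC
    rw [disjoint_right]
    exact fun y hy => (apply_eq_of_not_mem hr hq hz hzC ((hDmem y).1 hy)).1
  have hin : ∀ (C : Finset (Fin N)) (r : Perm (Fin N)), p ∉ C → r ∈ permsOfFinset Cᶜ →
      r⁻¹ * σ ∈ permsOfFinset (insert p C) → z ∈ C → D ⊆ C := by
    intro C r hp hr hq hzC
    exact fun y hy => (apply_eq_of_mem hp hr hq hz hzC ((hDmem y).1 hy)).1
  refine Finset.sum_involution (fun t _ => if z ∈ t.1 then (t.1 \ D, t.2 * δ) else
    (t.1 ∪ D, t.2 * δ⁻¹)) ?_ ?_ ?_ ?_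
  · rintro ⟨C, r⟩ ht
    simp only [mem_filter, mem_univ, true_and] at ht
    obtain ⟨hp, hr, hq⟩ := ht
    by_cases hzC : z ∈ C
    · have hsub := hin C r hp hr hq hzC
      have hc : (-1 : ℝ) ^ C.card = (-1) ^ (C \ D).card * (-1) ^ D.card := by
        rw [← pow_add, card_sdiff_add_card_eq_card hsub]
      simp only [hzC, if_true, hc, hsign, mul_inv_rev, mul_assoc, Perm.sign_mul, Perm.sign_inv]
      push_cast
      ring
    · have hc : (-1 : ℝ) ^ (C ∪ D).card = (-1) ^ C.card * (-1) ^ D.card := by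
        rw [← pow_add, card_union_of_disjoint (hout C r hp hr hq hzC)]
      have hs : ((Perm.sign δ : ℤ) : ℝ) * ((Perm.sign δ : ℤ) : ℝ) = 1 := by
        norm_cast
        rw [Int.units_mul_self]
        rfl
      simp only [hzC, if_false, hc, hsign, mul_inv_rev, mul_assoc, Perm.sign_mul, Perm.sign_inv,
        inv_inv]
      push_cast
      linear_combination -((-1 : ℝ) ^ C.card * ((Perm.sign r : ℤ) : ℝ) *
        ((Perm.sign σ : ℤ) : ℝ)) * hs
  · rintro ⟨C, r⟩ ht _ heq
    by_cases hzC : z ∈ C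
    · simp only [hzC, if_true, Prod.mk.injEq] at heq
      rw [← heq.1] at hzC
      exact (mem_sdiff.1 hzC).2 hzD
    · simp only [hzC, if_false, Prod.mk.injEq] at heq
      rw [← heq.1] at hzC
      exact hzC (mem_union_right _ hzD)
  · rintro ⟨C, r⟩ ht
    simp only [mem_filter, mem_univ, true_and] at ht
    obtain ⟨hp, hr, hq⟩ := ht
    by_cases hzC : z ∈ C
    · simp only [hzC, if_true, mem_filter, mem_univ, true_and]
      refine ⟨fun h => hp (mem_sdiff.1 h).1, ?_, ?_⟩
      · rw [mem_permsOfFinset]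
        intro x hx
        rw [mem_compl, not_not, mem_sdiff] at hx
        rw [Perm.mul_apply, hδ2 x hx.2, mem_permsOfFinset.1 hr x (by simpa using hx.1)]
      · rw [mem_permsOfFinset]
        intro x hx
        rw [mul_inv_rev, mul_assoc, Perm.mul_apply, Perm.inv_eq_iff_eq]
        by_cases hxD : x ∈ D
        · rw [(apply_eq_of_mem hp hr hq hz hzC ((hDmem x).1 hxD)).2, hδ1 x hxD]
        · rw [hδ2 x hxD]
          refine mem_permsOfFinset.1 hq x ?_
          simp only [mem_insert, mem_sdiff, not_or, not_and, not_not] at hx ⊢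
          exact ⟨hx.1, fun h => hxD (hx.2 h)⟩
    · simp only [hzC, if_false, mem_filter, mem_univ, true_and]
      refine ⟨by simp [hp, hpD], ?_, ?_⟩
      · rw [mem_permsOfFinset]
        intro x hx
        rw [mem_compl, not_not, mem_union] at hx
        rw [Perm.mul_apply]
        by_cases hxD : x ∈ D
        · have h1 := apply_mem_of_mem_permsOfFinset hδi hxD
          rw [← (apply_eq_of_not_mem hr hq hz hzC ((hDmem _).1 h1)).2, ← hδ1 _ h1]
          simp
        · rw [mem_permsOfFinset.1 hδi x hxD]
          exact mem_permsOfFinset.1 hr x (by simpa using hx.resolve_right hxD)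
      · rw [mem_permsOfFinset]
        intro x hx
        simp only [mem_insert, mem_union, not_or] at hx
        rw [mul_inv_rev, inv_inv, mul_assoc, Perm.mul_apply,
          mem_permsOfFinset.1 hq x (by simp [hx]), hδ2 x hx.2.2]
  · rintro ⟨C, r⟩ ht
    simp only [mem_filter, mem_univ, true_and] at ht
    obtain ⟨hp, hr, hq⟩ := ht
    by_cases hzC : z ∈ C
    · simp [hzC, hzD, sdiff_union_of_subset (hin C r hp hr hq hzC)]
    · simp [hzC, hzD, union_sdiff_cancel_right (hout C r hp hr hq hzC)]

theorem hookSum_eq_sum {N : ℕ} (s t : Finset (Fin N)) (F : Perm (Fin N) → ℝ) :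
    hookSum s t F = ∑ σ, ∑ r, if r ∈ permsOfFinset s ∧ r⁻¹ * σ ∈ permsOfFinset t then
      ((Perm.sign (r⁻¹ * σ) : ℤ) : ℝ) * F σ else 0 := by
  rw [sum_comm, hookSum, ← Finset.sum_filter_add_sum_filter_not univ (· ∈ permsOfFinset s)]
  rw [Finset.sum_eq_zero (s := univ.filter fun r => ¬ r ∈ permsOfFinset s), add_zero]
  · refine sum_congr (by ext; simp) fun r hr => ?_
    rw [← Equiv.sum_comp (Equiv.mulLeft r)]
    have hr' : r ∈ permsOfFinset s := (mem_filter.1 hr).2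
    simp only [hr', true_and, coe_mulLeft, inv_mul_cancel_left]
    rw [← sum_filter]
    exact sum_congr (by ext; simp) fun _ _ => rfl
  · intro r hr
    simp only [mem_filter, mem_univ, true_and] at hr
    simp [hr]

/-- Summing the hook sums over all hooks with corner `p` leaves only the full cycles. -/
theorem sum_hookSum_eq_zero {N : ℕ} (p : Fin N) (F : Perm (Fin N) → ℝ)
    (hF : ∀ σ, cycleCount σ = 1 → F σ = 0) :
    ∑ C ∈ univ.filter (fun C : Finset (Fin N) => p ∉ C),
      (-1 : ℝ) ^ C.card * hookSum Cᶜ (insert p C) F = 0 := by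
  simp only [hookSum_eq_sum, mul_sum]
  rw [sum_comm]
  refine sum_eq_zero fun σ _ => ?_
  by_cases hσ : cycleCount σ = 1
  · simp [hF σ hσ]
  · obtain ⟨z, hz⟩ : ∃ z, ¬ σ.SameCycle p z := by
      by_contra! h
      exact hσ (cycleCount_eq_one_of_forall_sameCycle h)
    have := sum_factorizations_eq_zero hz
    rw [sum_filter, ← univ_product_univ, sum_product] at this
    have this := congrArg (F σ * ·) this
    simp only [mul_sum, mul_zero] at this
    rw [sum_filter]
    refine Eq.trans (sum_congr rfl fun C _ => ?_) this
    by_cases hp : p ∈ C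
    · simp [hp]
    · simp only [hp, not_false_eq_true, if_true, true_and]
      refine sum_congr rfl fun r _ => ?_
      split_ifs <;> ring

theorem sum_permsOfFinset_mul_left {N : ℕ} {s : Finset (Fin N)} {τ : Perm (Fin N)}
    (hτ : τ ∈ permsOfFinset s) (H : Perm (Fin N) → ℝ) :
    ∑ σ ∈ permsOfFinset s, H (τ * σ) = ∑ σ ∈ permsOfFinset s, H σ :=
  Finset.sum_bij' (fun σ _ => τ * σ) (fun σ _ => τ⁻¹ * σ)
    (fun _ h => mul_mem_permsOfFinset hτ h)
    (fun _ h => mul_mem_permsOfFinset (inv_mem_permsOfFinset hτ) h)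
    (by simp) (by simp) (by simp)

theorem sum_permsOfFinset_mul_right {N : ℕ} {s : Finset (Fin N)} {τ : Perm (Fin N)}
    (hτ : τ ∈ permsOfFinset s) (H : Perm (Fin N) → ℝ) :
    ∑ σ ∈ permsOfFinset s, H (σ * τ) = ∑ σ ∈ permsOfFinset s, H σ :=
  Finset.sum_bij' (fun σ _ => σ * τ) (fun σ _ => σ * τ⁻¹)
    (fun _ h => mul_mem_permsOfFinset h hτ)
    (fun _ h => mul_mem_permsOfFinset h (inv_mem_permsOfFinset hτ))
    (by simp) (by simp) (by simp)

theorem mul_injOn_permsOfFinset {N : ℕ} {p : Fin N} {s t : Finset (Fin N)} (hst : s ∩ t = {p})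
    {r r' q q' : Perm (Fin N)} (hr : r ∈ permsOfFinset s) (hr' : r' ∈ permsOfFinset s)
    (hq : q ∈ permsOfFinset t) (hq' : q' ∈ permsOfFinset t) (h : r * q = r' * q') :
    r = r' ∧ q = q' := by
  have h1 : r'⁻¹ * r = q' * q⁻¹ := by
    rw [inv_mul_eq_iff_eq_mul, ← mul_assoc, ← h, mul_inv_cancel_right]
  have h2 : r'⁻¹ * r ∈ permsOfFinset (s ∩ t) := by
    rw [mem_permsOfFinset]
    intro x hx
    rw [mem_inter, not_and_or] at hx
    rcases hx with hx | hx
    · exact mem_permsOfFinset.1 (mul_mem_permsOfFinset (inv_mem_permsOfFinset hr') hr) x hx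
    · rw [h1]
      exact mem_permsOfFinset.1 (mul_mem_permsOfFinset hq' (inv_mem_permsOfFinset hq)) x hx
  rw [hst, permsOfFinset_singleton, mem_singleton] at h2
  rw [h2] at h1
  exact ⟨(inv_mul_eq_one.1 h2).symm, (mul_inv_eq_one.1 h1.symm).symm⟩

/-- Young's combinatorial lemma for hooks. -/
theorem exists_mul_or_exists_pair {N : ℕ} {p : Fin N} {C : Finset (Fin N)} (hp : p ∉ C)
    (σ : Perm (Fin N)) :
    (∃ r ∈ permsOfFinset Cᶜ, ∃ q ∈ permsOfFinset (insert p C), r * q = σ) ∨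
      ∃ i ∈ insert p C, ∃ j ∈ insert p C, i ≠ j ∧ σ i ∈ Cᶜ ∧ σ j ∈ Cᶜ := by
  rw [or_iff_not_imp_right]
  intro hno
  obtain ⟨x, hx, hσx⟩ : ∃ x ∈ insert p C, σ x ∉ C := by
    by_contra! h
    have := Finset.card_le_card_of_injOn σ h σ.injective.injOn
    rw [card_insert_of_notMem hp] at this
    omega
  have huniq : ∀ y ∈ insert p C, y ≠ x → σ y ∈ C := by
    intro y hy hyx
    by_contra h
    exact hno ⟨y, hy, x, hx, hyx, mem_compl.2 h, mem_compl.2 hσx⟩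
  let f : Fin N → Fin N := fun y => if y ∈ insert p C then (if y = x then p else σ y) else y
  have hf1 : f x = p := by simp only [f, hx, if_true]
  have hf2 : ∀ y ∈ insert p C, y ≠ x → f y = σ y := fun y hy hyx => by
    simp only [f, hy, if_true, hyx, if_false]
  have hf3 : ∀ y ∉ insert p C, f y = y := fun y hy => by simp only [f, hy, if_false]
  have hf4 : ∀ y ∈ insert p C, f y ∈ insert p C := by
    intro y hy
    by_cases hyx : y = x
    · rw [hyx, hf1]
      exact mem_insert_self _ _
    · rw [hf2 y hy hyx]
      exact mem_insert_of_mem (huniq y hy hyx)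
  have hinj : Function.Injective f := by
    intro y y' h
    by_cases hy : y ∈ insert p C <;> by_cases hy' : y' ∈ insert p C
    · by_cases hyx : y = x <;> by_cases hyx' : y' = x
      · rw [hyx, hyx']
      · rw [hyx, hf1, hf2 y' hy' hyx'] at h
        exact absurd (h ▸ huniq y' hy' hyx') hp
      · rw [hyx', hf1, hf2 y hy hyx] at h
        exact absurd (h ▸ huniq y hy hyx) hp
      · rw [hf2 y hy hyx, hf2 y' hy' hyx'] at h
        exact σ.injective h
    · rw [hf3 y' hy'] at h
      exact absurd (h ▸ hf4 y hy) hy'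
    · rw [hf3 y hy] at h
      exact absurd (h ▸ hf4 y' hy') hy
    · rwa [hf3 y hy, hf3 y' hy'] at h
  let q : Perm (Fin N) := Equiv.ofBijective f (Finite.injective_iff_bijective.1 hinj)
  have hqf : ∀ y, q y = f y := fun y => rfl
  refine ⟨σ * q⁻¹, ?_, q, mem_permsOfFinset.2 hf3, by simp⟩
  rw [mem_permsOfFinset]
  intro c hc
  rw [mem_compl, not_not] at hc
  obtain ⟨y, hy⟩ := q.surjective c
  have hy1 : y ∈ insert p C := by
    by_contra h
    rw [hqf, hf3 y h] at hy
    exact h (hy ▸ mem_insert_of_mem hc)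
  have hy2 : y ≠ x := by
    intro h
    rw [h, hqf, hf1] at hy
    exact hp (hy ▸ hc)
  rw [Perm.mul_apply, Perm.inv_eq_iff_eq.2 hy.symm, ← hf2 y hy1 hy2, ← hqf, hy]

theorem compl_inter_insert {N : ℕ} {p : Fin N} {C : Finset (Fin N)} (hp : p ∉ C) :
    Cᶜ ∩ insert p C = {p} := by
  ext x
  simp only [mem_inter, mem_compl, mem_insert, mem_singleton]
  grind

/-- The hook Young symmetrizer is an eigenvector of the Gram matrix, expressed through the
convolution inverse `w` of `X ^ cycleCount`. -/
theorem hookSum_mul_hookSum {N : ℕ} {X : ℝ} {w : Perm (Fin N) → ℝ}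
    (hw : ∀ β, ∑ σ, w σ * X ^ cycleCount (σ⁻¹ * β) = if β = 1 then 1 else 0)
    {p : Fin N} {C : Finset (Fin N)} (hp : p ∉ C) :
    hookSum Cᶜ (insert p C) w * hookSum Cᶜ (insert p C) (fun σ => X ^ cycleCount σ) = 1 := by
  set s := Cᶜ with hs
  set t := insert p C with ht
  have hst : s ∩ t = {p} := compl_inter_insert hp
  have hone : ∀ u : Finset (Fin N), (1 : Perm (Fin N)) ∈ permsOfFinset u := fun u =>
    mem_permsOfFinset.2 fun _ _ => rfl
  let φ : Perm (Fin N) → ℝ := fun σ => ∑ r ∈ permsOfFinset s, ∑ q ∈ permsOfFinset t,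
    ((Perm.sign q : ℤ) : ℝ) * w (r * σ * q)
  have hφ : ∀ σ, φ σ = ∑ r ∈ permsOfFinset s, ∑ q ∈ permsOfFinset t,
    ((Perm.sign q : ℤ) : ℝ) * w (r * σ * q) := fun _ => rfl
  have hφ1 : φ 1 = hookSum s t w := by simp [hφ, hookSum]
  have hφl : ∀ r ∈ permsOfFinset s, ∀ σ, φ (r * σ) = φ σ := by
    intro r hr σ
    rw [hφ, hφ, ← sum_permsOfFinset_mul_right hr (fun r => ∑ q ∈ permsOfFinset t,
      ((Perm.sign q : ℤ) : ℝ) * w (r * σ * q))]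
    simp only [mul_assoc]
  have hφr : ∀ q ∈ permsOfFinset t, ∀ σ, φ (σ * q) = ((Perm.sign q : ℤ) : ℝ) * φ σ := by
    intro q hq σ
    have hsq : ((Perm.sign q : ℤ) : ℝ) * ((Perm.sign q : ℤ) : ℝ) = 1 := by
      norm_cast
      rw [Int.units_mul_self]
      rfl
    rw [hφ, hφ, mul_sum]
    refine sum_congr rfl fun r _ => ?_
    rw [← sum_permsOfFinset_mul_left hq (fun q => ((Perm.sign q : ℤ) : ℝ) * w (r * σ * q)), mul_sum]
    refine sum_congr rfl fun q' _ => ?_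
    simp only [Perm.sign_mul, mul_assoc]
    push_cast
    linear_combination -(((Perm.sign q' : ℤ) : ℝ) * w (r * (σ * (q * q')))) * hsq
  have hφ0 : ∀ σ, (∀ r ∈ permsOfFinset s, ∀ q ∈ permsOfFinset t, r * q ≠ σ) → φ σ = 0 := by
    intro σ hσ
    rcases exists_mul_or_exists_pair hp σ with ⟨r, hr, q, hq, h⟩ | ⟨i, hi, j, hj, hij, h1, h2⟩
    · exact absurd h (hσ r hr q hq)
    · have e1 := hφr _ (swap_mem_permsOfFinset hi hj) σ
      rw [Equiv.mul_swap_eq_swap_mul, hφl _ (swap_mem_permsOfFinset h1 h2), Perm.sign_swap hij] at e1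
      push_cast at e1
      linarith
  have hsum : ∑ σ, X ^ cycleCount σ * φ σ = 1 := by
    have h1 : hookSum s t (fun β => ∑ σ, w σ * X ^ cycleCount (σ⁻¹ * β)) = 1 := by
      simp only [hw]
      rw [hookSum, ← sum_product', sum_eq_single ((1 : Perm (Fin N)), (1 : Perm (Fin N)))]
      · simp
      · rintro ⟨r, q⟩ hrq hne
        rw [mem_product] at hrq
        have : r * q ≠ 1 := fun h => hne <| by
          have := mul_injOn_permsOfFinset hst hrq.1 (hone s) hrq.2 (hone t) (by rw [h, mul_one])
          exact Prod.ext this.1 this.2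
        simp [this]
      · intro h
        exact absurd (mem_product.2 ⟨hone s, hone t⟩) h
    rw [← h1]
    simp only [hφ, hookSum, mul_sum]
    rw [sum_comm]
    refine sum_congr rfl fun r _ => ?_
    rw [sum_comm]
    refine sum_congr rfl fun q _ => ?_
    rw [← Equiv.sum_comp ((Equiv.mulLeft r).trans (Equiv.mulRight q))
      (fun σ => ((Perm.sign q : ℤ) : ℝ) * (w σ * X ^ cycleCount (σ⁻¹ * (r * q))))]
    refine sum_congr rfl fun σ _ => ?_
    have : cycleCount ((r * σ * q)⁻¹ * (r * q)) = cycleCount σ := by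
      rw [← cycleCount_inv σ, ← cycleCount_conj σ⁻¹ q⁻¹]
      congr 1
      group
    simp only [Equiv.trans_apply, coe_mulLeft, coe_mulRight, this]
    ring
  rw [← hsum, ← hφ1]
  have himg : ∑ σ ∈ (permsOfFinset s ×ˢ permsOfFinset t).image (fun t => t.1 * t.2),
      X ^ cycleCount σ * φ σ = ∑ σ, X ^ cycleCount σ * φ σ := by
    refine sum_subset (subset_univ _) fun σ _ hσ => ?_
    rw [hφ0 σ, mul_zero]
    intro r hr q hq h
    exact hσ (mem_image.2 ⟨(r, q), mem_product.2 ⟨hr, hq⟩, h⟩)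
  rw [← himg, sum_image, sum_product, hookSum, mul_sum]
  · refine sum_congr rfl fun r hr => ?_
    rw [mul_sum]
    refine sum_congr rfl fun q hq => ?_
    have := hφr q hq 1
    rw [one_mul] at this
    simp only [hφl r hr, this]
    ring
  · rintro ⟨r, q⟩ h ⟨r', q'⟩ h' heq
    rw [mem_coe, mem_product] at h h'
    have := mul_injOn_permsOfFinset hst h.1 h'.1 h.2 h'.2 heq
    exact Prod.ext this.1 this.2

theorem eq_zero_of_sum_eq_zero {n : ℕ} {X : ℝ} (hX : 0 < X) (hn : (n : ℝ) ≤ X)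
    (s : Finset (Fin n)) (v : Perm (Fin n) → ℝ)
    (h : ∀ σ, ∑ π ∈ permsOfFinset s, X ^ cycleCount π * v (σ * π) = 0) : v = 0 := by
  induction s using Finset.induction_on with
  | empty =>
    funext σ
    simpa [permsOfFinset_empty, hX.ne'] using h σ
  | insert a s ha ih =>
    apply ih
    set u : Perm (Fin n) → ℝ := fun σ =>
      ∑ π ∈ permsOfFinset s, X ^ cycleCount π * v (σ * π) with hu
    have hrec : ∀ σ, X * u σ = -∑ x ∈ s, u (σ * swap a x) := by
      intro σ
      have h1 := h σ
      rw [sum_permsOfFinset_insert ha] at h1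
      have h2 := congrArg (X * ·) h1
      simp only [mul_add, mul_zero, mul_sum s] at h2
      rw [eq_neg_iff_add_eq_zero, ← h2]
      congr 1
      refine sum_congr rfl fun x hx => ?_
      rw [hu, mul_sum]
      refine sum_congr rfl fun π hπ => ?_
      rw [← cycleCount_swap_mul (mem_permsOfFinset.1 hπ a ha) (fun h => ha (h ▸ hx) : x ≠ a),
        pow_succ, mul_assoc σ]
      ring
    obtain ⟨σ₀, hσ₀⟩ := Finite.exists_max fun σ => |u σ|
    have hcard : (s.card : ℝ) + 1 ≤ n := by
      have := card_lt_univ_of_notMem ha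
      rw [Fintype.card_fin] at this
      exact_mod_cast this
    have hle : X * |u σ₀| ≤ s.card * |u σ₀| := by
      have e : X * |u σ₀| = |X * u σ₀| := by rw [abs_mul, abs_of_pos hX]
      rw [e, hrec, abs_neg]
      refine (abs_sum_le_sum_abs _ _).trans ?_
      rw [← nsmul_eq_mul]
      exact sum_le_card_nsmul _ _ _ fun x _ => hσ₀ _
    have h0 : |u σ₀| ≤ 0 := by nlinarith [abs_nonneg (u σ₀)]
    exact fun σ => abs_nonpos_iff.1 ((hσ₀ σ).trans h0)

theorem isUnit_GramU {d n : ℕ} (hn : 0 < n) (hdn : n ≤ d) : IsUnit (GramU d n) := by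
  rw [Matrix.isUnit_iff_isUnit_det, isUnit_iff_ne_zero]
  intro h
  obtain ⟨v, hv, h0⟩ := Matrix.exists_mulVec_eq_zero_iff.2 h
  refine hv (eq_zero_of_sum_eq_zero (X := d) (by exact_mod_cast hn.trans_le hdn)
    (by exact_mod_cast hdn) univ v fun σ => ?_)
  have h1 := congrFun h0 σ
  rw [Matrix.mulVec, dotProduct, ← Equiv.sum_comp (Equiv.mulLeft σ)] at h1
  simpa [GramU, show permsOfFinset (univ : Finset (Fin n)) = univ by
    ext; simp [mem_permsOfFinset]] using h1

theorem hookSum_compl_cycleCount {m : ℕ} {R : Type*} [CommRing R] [IsDomain R] {X : R} (hX : X ≠ 0)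
    {p : Fin (m + 1)} {C : Finset (Fin (m + 1))} (hp : p ∉ C) :
    hookSum Cᶜ (insert p C) (fun σ => X ^ cycleCount σ) =
      X * (∏ j ∈ range (m - C.card), (X + (j + 1 : ℕ))) * ∏ j ∈ range C.card, (X - (j + 1 : ℕ)) := by
  have h1 : (insert p C)ᶜ.card = m - C.card := by
    rw [card_compl, card_insert_of_notMem hp, Fintype.card_fin]
    omega
  have h2 : C.card ≤ m := by
    have := card_lt_univ_of_notMem hp
    rw [Fintype.card_fin] at this
    omega
  have h3 : insert p (insert p C)ᶜ = Cᶜ := by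
    ext x
    simp only [mem_insert, mem_compl]
    grind
  have h := hookSum_cycleCount (X := X) C hp (insert p C)ᶜ (by simp)
    (disjoint_compl_left.mono_right (subset_insert p C))
  rw [h1, h3, Nat.sub_add_cancel h2, pow_succ, mul_assoc, mul_assoc] at h
  rw [mul_left_cancel₀ (pow_ne_zero m hX) h, mul_assoc]

open Polynomial in
theorem coeff_hookSum {N : ℕ} (s t : Finset (Fin N)) (F : Perm (Fin N) → ℝ[X]) (i : ℕ) :
    (hookSum s t F).coeff i = hookSum s t (fun σ => (F σ).coeff i) := by
  simp only [hookSum, finsetSum_coeff, coeff_intCast_mul]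

open Polynomial in
/-- The signed number of full cycles in a hook Young symmetrizer. -/
theorem hookSum_ite_cycleCount_eq_one {m : ℕ} {p : Fin (m + 1)} {C : Finset (Fin (m + 1))}
    (hp : p ∉ C) :
    hookSum Cᶜ (insert p C) (fun σ => if cycleCount σ = 1 then (1 : ℝ) else 0) =
      (m - C.card).factorial * ((-1) ^ C.card * C.card.factorial) := by
  have h := congrArg (fun q : ℝ[X] => q.coeff 1)
    (hookSum_compl_cycleCount (X := (Polynomial.X : ℝ[X])) X_ne_zero hp)
  simp only [coeff_hookSum, coeff_X_pow, mul_assoc] at h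
  simp only [eq_comm (a := 1)] at h
  rw [h, coeff_X_mul, coeff_zero_eq_eval_zero, eval_mul, eval_prod, eval_prod]
  have e : ∀ a : ℕ, ∏ j ∈ range a, ((j + 1 : ℕ) : ℝ) = a.factorial := fun a => by
    rw [← prod_range_add_one_eq_factorial]
    push_cast
    rfl
  congr 1
  · rw [← e]
    simp
  · rw [← e]
    conv_rhs => enter [1]; rw [← card_range C.card, ← prod_const]
    rw [← prod_mul_distrib]
    simp

open Polynomial in
theorem prod_range_add_sub (m : ℕ) (r s : ℝ) :
    ∏ i ∈ range m, (r + s - i) = ∑ k ∈ range (m + 1), (m.choose k : ℝ) *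
      ((∏ i ∈ range k, (r - i)) * ∏ i ∈ range (m - k), (s - i)) := by
  have e : ∀ (k : ℕ) (x : ℝ), (descPochhammer ℤ k).smeval x = ∏ i ∈ range k, (x - i) := by
    intro k x
    rw [← descPochhammer_eval_eq_prod_range, ← aeval_eq_smeval, ← descPochhammer_map (Int.castRingHom ℝ),
      eval_map, aeval_def]
    rfl
  rw [← e, Ring.descPochhammer_smeval_add m (Commute.all r s),
    Finset.Nat.sum_antidiagonal_eq_sum_range_succ_mk]
  simp only [e]

theorem prod_range_two_mul_sub (m : ℕ) :
    ∏ i ∈ range m, ((2 * m : ℕ) - i : ℝ) = (m + 1).factorial * catalan m := by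
  rw [← descPochhammer_eval_eq_prod_range, descPochhammer_eval_eq_descFactorial,
    Nat.descFactorial_eq_factorial_mul_choose, ← Nat.centralBinom_eq_two_mul_choose,
    ← succ_mul_catalan_eq_centralBinom, Nat.factorial_succ]
  push_cast
  ring

theorem sum_choose_mul_inv {m : ℕ} {x : ℝ} (hx : (m : ℝ) < x) :
    ∑ k ∈ range (m + 1), (m.choose k : ℝ) * ((-1) ^ k *
      (x * (∏ j ∈ range (m - k), (x + (j + 1 : ℕ))) * ∏ j ∈ range k, (x - (j + 1 : ℕ)))⁻¹) =
    (m + 1).factorial * ((-1) ^ m * catalan m *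
      (x * (∏ j ∈ range m, (x + (j + 1 : ℕ))) * ∏ j ∈ range m, (x - (j + 1 : ℕ)))⁻¹) := by
  have hx0 : 0 < x := (Nat.cast_nonneg m).trans_lt hx
  have hP : ∀ a : ℕ, ∏ j ∈ range a, (x + (j + 1 : ℕ)) ≠ 0 := fun a =>
    (prod_pos fun j _ => by positivity).ne'
  have hQ : ∀ a ≤ m, ∏ j ∈ range a, (x - (j + 1 : ℕ)) ≠ 0 := fun a ha =>
    (prod_pos fun j hj => by
      have : j + 1 ≤ m := (mem_range.1 hj).trans_le ha
      have : ((j + 1 : ℕ) : ℝ) ≤ m := by exact_mod_cast this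
      linarith).ne'
  have hcat := prod_range_two_mul_sub m
  have hsum : ∀ i : ℕ, ((2 * m : ℕ) - i : ℝ) = (x + m) + (m - x) - i := fun i => by
    push_cast
    ring
  simp only [hsum] at hcat
  rw [prod_range_add_sub] at hcat
  rw [← mul_assoc, mul_left_comm, ← hcat, mul_sum, sum_mul]
  refine sum_congr rfl fun k hk => ?_
  have hk : k ≤ m := Nat.lt_succ_iff.1 (mem_range.1 hk)
  have h1 : ∏ j ∈ range m, (x + (j + 1 : ℕ)) =
      (∏ j ∈ range (m - k), (x + (j + 1 : ℕ))) * ∏ i ∈ range k, (x + m - i) := by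
    conv_lhs => rw [← Nat.sub_add_cancel hk, prod_range_add]
    congr 1
    rw [← prod_range_reflect]
    refine prod_congr rfl fun j hj => ?_
    have : m - k + (k - 1 - j) + 1 = m - j := by
      have := mem_range.1 hj
      omega
    rw [this, Nat.cast_sub ((mem_range.1 hj).le.trans hk)]
    ring
  have h2 : ∏ j ∈ range m, (x - (j + 1 : ℕ)) =
      (∏ j ∈ range k, (x - (j + 1 : ℕ))) * ((-1) ^ (m - k) * ∏ i ∈ range (m - k), (m - x - i)) := by
    conv_lhs => rw [← Nat.add_sub_cancel' hk, prod_range_add]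
    congr 1
    conv_rhs => rw [← card_range (m - k), ← prod_const, card_range, ← prod_mul_distrib]
    rw [← prod_range_reflect]
    refine prod_congr rfl fun j hj => ?_
    have : k + (m - k - 1 - j) + 1 = m - j := by
      have := mem_range.1 hj
      omega
    rw [this, Nat.cast_sub ((mem_range.1 hj).le.trans (Nat.sub_le m k))]
    ring
  have h3 : (-1 : ℝ) ^ m = (-1) ^ k * (-1) ^ (m - k) := by rw [← pow_add, Nat.add_sub_cancel' hk]
  have h4 := hP m
  have h5 := hQ m le_rfl
  rw [h1] at h4
  rw [h2] at h5
  rw [h1, h2, h3]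
  have h6 := left_ne_zero_of_mul h4
  have h7 := right_ne_zero_of_mul h4
  have h8 := left_ne_zero_of_mul h5
  have h9 := right_ne_zero_of_mul (right_ne_zero_of_mul h5)
  field_simp

theorem prod_Icc_sub_intCast (m : ℕ) (x : ℝ) :
    ∏ j ∈ Finset.Icc (-(m : ℤ)) m, (x - (j : ℝ)) =
      x * (∏ j ∈ range m, (x + (j + 1 : ℕ))) * ∏ j ∈ range m, (x - (j + 1 : ℕ)) := by
  induction m with
  | zero => simp
  | succ m ih =>
    have h : Finset.Icc (-((m + 1 : ℕ) : ℤ)) (m + 1 : ℕ) =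
        insert (-((m + 1 : ℕ) : ℤ)) (insert ((m + 1 : ℕ) : ℤ) (Finset.Icc (-(m : ℤ)) m)) := by
      ext j
      simp only [Finset.mem_Icc, mem_insert]
      omega
    rw [h, prod_insert (by simp; omega), prod_insert (by simp), ih, prod_range_succ, prod_range_succ]
    push_cast
    ring

theorem inv_GramU_mul_left (d n : ℕ) (ρ σ τ : Perm (Fin n)) :
    (GramU d n)⁻¹ (ρ * σ) (ρ * τ) = (GramU d n)⁻¹ σ τ := by
  have h : (GramU d n).submatrix (Equiv.mulLeft ρ) (Equiv.mulLeft ρ) = GramU d n := by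
    ext σ τ
    simp [GramU, mul_assoc]
  conv_rhs => rw [← h, Matrix.inv_submatrix_equiv]
  rfl

theorem inv_GramU_mul_right (d n : ℕ) (ρ σ τ : Perm (Fin n)) :
    (GramU d n)⁻¹ (σ * ρ) (τ * ρ) = (GramU d n)⁻¹ σ τ := by
  have h : (GramU d n).submatrix (Equiv.mulRight ρ) (Equiv.mulRight ρ) = GramU d n := by
    ext σ τ
    rw [Matrix.submatrix_apply, GramU, GramU, ← cycleCount_conj (σ⁻¹ * τ) ρ⁻¹]
    simp [mul_assoc]
  conv_rhs => rw [← h, Matrix.inv_submatrix_equiv]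
  rfl

theorem inv_GramU_eq_of_cycleCount_eq_one {d n : ℕ} {σ τ : Perm (Fin n)} (hσ : cycleCount σ = 1)
    (hτ : cycleCount τ = 1) : (GramU d n)⁻¹ 1 σ = (GramU d n)⁻¹ 1 τ := by
  obtain ⟨ρ, hρ⟩ := isConj_iff.1
    (Perm.isConj_iff_cycleType_eq.2 (cycleType_eq_of_cycleCount_eq_one hσ hτ))
  rw [← hρ, ← inv_GramU_mul_right d n ρ 1 (ρ * σ * ρ⁻¹), inv_mul_cancel_right,
    one_mul, ← inv_GramU_mul_left d n ρ 1 σ, mul_one]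

theorem sum_filter_notMem_apply_card {m : ℕ} (p : Fin (m + 1)) (f : ℕ → ℝ) :
    ∑ C ∈ univ.filter (fun C : Finset (Fin (m + 1)) => p ∉ C), f C.card =
      ∑ k ∈ range (m + 1), (m.choose k : ℝ) * f k := by
  have h : univ.filter (fun C : Finset (Fin (m + 1)) => p ∉ C) = (univ.erase p).powerset := by
    ext C
    simp [subset_erase]
  rw [h, sum_powerset_apply_card]
  simp

theorem inv_GramU_one_apply {d m : ℕ} (hd : m < d) {τ : Perm (Fin (m + 1))}
    (hτ : cycleCount τ = 1) :
    (GramU d (m + 1))⁻¹ 1 τ = (-1) ^ m * catalan m *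
      (d * (∏ j ∈ range m, ((d : ℝ) + (j + 1 : ℕ))) * ∏ j ∈ range m, ((d : ℝ) - (j + 1 : ℕ)))⁻¹ := by
  have hd0 : (d : ℝ) ≠ 0 := by
    have : d ≠ 0 := by omega
    exact_mod_cast this
  set w : Perm (Fin (m + 1)) → ℝ := fun σ => (GramU d (m + 1))⁻¹ 1 σ
  have hw : ∀ β, ∑ σ, w σ * (d : ℝ) ^ cycleCount (σ⁻¹ * β) = if β = 1 then 1 else 0 := by
    intro β
    have h := congrFun (congrFun (Matrix.nonsing_inv_mul (GramU d (m + 1))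
      ((Matrix.isUnit_iff_isUnit_det _).1 (isUnit_GramU m.succ_pos hd))) 1) β
    rw [Matrix.mul_apply, Matrix.one_apply] at h
    simp only [eq_comm (a := β)]
    exact h
  let p : Fin (m + 1) := 0
  have key := sum_hookSum_eq_zero p (fun σ => w σ - w τ * if cycleCount σ = 1 then 1 else 0)
    (fun σ hσ => by
      rw [if_pos hσ, mul_one, sub_eq_zero]
      exact inv_GramU_eq_of_cycleCount_eq_one hσ hτ)
  let f : ℕ → ℝ := fun k => (-1 : ℝ) ^ k * (d * (∏ j ∈ range (m - k), ((d : ℝ) + (j + 1 : ℕ))) *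
    ∏ j ∈ range k, ((d : ℝ) - (j + 1 : ℕ)))⁻¹ - w τ * ((m - k).factorial * k.factorial)
  have hterm : ∀ C ∈ univ.filter (fun C : Finset (Fin (m + 1)) => p ∉ C),
      (-1 : ℝ) ^ C.card * hookSum Cᶜ (insert p C)
        (fun σ => w σ - w τ * if cycleCount σ = 1 then 1 else 0) =
      f C.card := by
    intro C hC
    have hp : p ∉ C := (mem_filter.1 hC).2
    have h1 : hookSum Cᶜ (insert p C) (fun σ => w σ - w τ * if cycleCount σ = 1 then 1 else 0) =
        hookSum Cᶜ (insert p C) w -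
          w τ * hookSum Cᶜ (insert p C) (fun σ => if cycleCount σ = 1 then 1 else 0) := by
      simp only [hookSum, mul_sub, sum_sub_distrib, mul_sum]
      simp only [mul_left_comm]
    have h2 := hookSum_mul_hookSum hw hp
    rw [hookSum_compl_cycleCount hd0 hp] at h2
    have h3 : (-1 : ℝ) ^ C.card * (-1) ^ C.card = 1 := by
      rw [← mul_pow]
      simp
    rw [h1, eq_inv_of_mul_eq_one_left h2, hookSum_ite_cycleCount_eq_one hp]
    linear_combination (-w τ * ((m - C.card).factorial * C.card.factorial)) * h3
  replace key := (sum_filter_notMem_apply_card p f).symm.trans ((sum_congr rfl hterm).symm.trans key)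
  simp only [f, mul_sub, sum_sub_distrib] at key
  rw [sum_choose_mul_inv (by exact_mod_cast hd), sub_eq_zero] at key
  have hfac : ∑ k ∈ range (m + 1), (m.choose k : ℝ) * (w τ * ((m - k).factorial * k.factorial)) =
      (m + 1).factorial * w τ := by
    have : ∀ k ∈ range (m + 1), (m.choose k : ℝ) * (w τ * ((m - k).factorial * k.factorial)) =
        m.factorial * w τ := fun k hk => by
      have := Nat.choose_mul_factorial_mul_factorial (Nat.lt_succ_iff.1 (mem_range.1 hk))
      rw [← this]
      push_cast
      ring
    rw [sum_congr rfl this, sum_const, card_range, nsmul_eq_mul, Nat.factorial_succ]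
    push_cast
    ring
  rw [hfac] at key
  exact (mul_left_cancel₀ (by exact_mod_cast (m + 1).factorial_ne_zero) key).symm

end GramMatrix

theorem stmt14 (d n : ℕ) (hn : 0 < n) (hdn : d ≥ n) :
    IsUnit (GramU d n) ∧
    ∀ σ τ : Equiv.Perm (Fin n), cycleCount (σ⁻¹ * τ) = 1 →
      (GramU d n)⁻¹ σ τ =
        (-1 : ℝ) ^ (n - 1) * (catalan (n-1) : ℝ) *
          ∏ j ∈ Finset.Icc (-(n : ℤ) + 1) ((n : ℤ) - 1), ((d : ℝ) - (j : ℝ))⁻¹ := by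
  refine ⟨isUnit_GramU hn hdn, fun σ τ h => ?_⟩
  obtain ⟨m, rfl⟩ : ∃ m, n = m + 1 := ⟨n - 1, by omega⟩
  have hl : -((m + 1 : ℕ) : ℤ) + 1 = -(m : ℤ) := by push_cast; ring
  have hr : ((m + 1 : ℕ) : ℤ) - 1 = (m : ℤ) := by push_cast; ring
  rw [hl, hr, Finset.prod_inv_distrib, prod_Icc_sub_intCast, Nat.add_sub_cancel,
    ← inv_GramU_one_apply hdn h, ← inv_GramU_mul_left d (m + 1) σ⁻¹ σ τ, inv_mul_cancel]
end

section
/- Let d and n be positive integers with d ≥ n, and let Wg = (G_n^{O(d)})⁻¹ be the inverse of the Gram matrix. Then the entries of Wg depend only on the coset type: for 𝔪₁, 𝔫₁, 𝔪₂, 𝔫₂ ∈ M(2n), if the permutations 𝔪₁∘𝔫₁ and 𝔪₂∘𝔫₂ of Fin (2n) have the same cycle type, then Wg(𝔪₁,𝔫₁) = Wg(𝔪₂,𝔫₂). -/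
/-- A pair partition of `{1,…,N}` identified with a fixed-point-free involution of `Fin N`. -/
def IsPairMatching {N : ℕ} (m : Equiv.Perm (Fin N)) : Prop :=
  (∀ x, m (m x) = x) ∧ (∀ x, m x ≠ x)

instance {N : ℕ} : DecidablePred (IsPairMatching (N := N)) := fun _ => by
  unfold IsPairMatching; infer_instance

/-- `Matchings N` is the set `M(N)` of pair partitions (fixed-point-free involutions). -/
def Matchings (N : ℕ) : Type := {m : Equiv.Perm (Fin N) // IsPairMatching m}

instance (N : ℕ) : Fintype (Matchings N) := Subtype.fintype _
instance (N : ℕ) : DecidableEq (Matchings N) := Subtype.instDecidableEq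

/-- `loop(𝔪,𝔫)`: half the number of orbits of `𝔪 ∘ 𝔫`. -/
def loopCount {N : ℕ} (m p : Matchings N) : ℕ := cycleCount (m.1 * p.1) / 2

/-- The orthogonal Gram matrix `G_n^{O(d)}`. -/
noncomputable def GramO (d n : ℕ) : Matrix (Matchings (2*n)) (Matchings (2*n)) ℝ :=
  fun m p => (d : ℝ) ^ loopCount m p

namespace Equiv.Perm

/-- The product of two fixed-point-free involutions `m`, `p` never moves `x` along its cycle
to `m x`. -/
theorem not_sameCycle_mul_of_involutive {α : Type*} {m p : Perm α}
    (hm : ∀ x, m (m x) = x) (hp : ∀ x, p (p x) = x) (hm' : ∀ x, m x ≠ x) (hp' : ∀ x, p x ≠ x)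
    (x : α) : ¬ (m * p).SameCycle x (m x) := by
  have hminv : m⁻¹ = m := by ext y; rw [inv_eq_iff_eq, hm]
  have hpinv : p⁻¹ = p := by ext y; rw [inv_eq_iff_eq, hp]
  have hmm : m * m = 1 := by ext y; simp [hm]
  have hconj : m * (m * p) * m⁻¹ = (m * p)⁻¹ := by
    rw [mul_inv_rev, hminv, hpinv, ← mul_assoc m m p, hmm, one_mul]
  have hpow (j : ℤ) (y : α) : m (((m * p) ^ j) y) = ((m * p) ^ (-j)) (m y) := by
    have : m * (m * p) ^ j = (m * p) ^ (-j) * m := by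
      rw [zpow_neg, ← inv_zpow, ← hconj, conj_zpow, inv_mul_cancel_right]
    exact congrArg (fun g : Perm α => g y) this
  rintro ⟨k, hk⟩
  obtain ⟨j, rfl | rfl⟩ := Int.even_or_odd' k
  · apply hm' (((m * p) ^ j) x)
    rw [hpow, ← hk, ← mul_apply, ← zpow_add]
    congr 2
    ring
  · apply hp' (((m * p) ^ j) x)
    apply m.injective
    rw [hpow, ← hk, ← mul_apply m p, ← mul_apply, ← mul_apply, ← zpow_add, ← zpow_one_add]
    congr 2
    ring

/-- The ground set splits into two halves invariant under `m * p` and exchanged by `m`. -/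
theorem exists_invariant_half {α : Type*} [LinearOrder α] {m p : Perm α}
    (hm : ∀ x, m (m x) = x) (hp : ∀ x, p (p x) = x) (hm' : ∀ x, m x ≠ x) (hp' : ∀ x, p x ≠ x) :
    ∃ A : α → Prop, (∀ x, A ((m * p) x) ↔ A x) ∧ ∀ x, A (m x) ↔ ¬ A x := by
  let r : α → α := fun x => (Quotient.mk (SameCycle.setoid (m * p)) x).out
  have hr (x y : α) : r x = r y ↔ (m * p).SameCycle x y := by
    rw [Quotient.out_inj]
    exact Quotient.eq
  have h1 (x : α) : r ((m * p) x) = r x := (hr _ _).2 (sameCycle_apply_left.2 (.refl _ _))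
  have h2 (x : α) : r (m ((m * p) x)) = r (m x) := by
    rw [hr, mul_apply, hm]
    have : (m * p) (p x) = m x := by simp [hp]
    rw [← this]
    exact sameCycle_apply_right.2 (.refl _ _)
  refine ⟨fun x => r x < r (m x), fun x => by simp only [h1, h2], fun x => ?_⟩
  have hne : r x ≠ r (m x) := fun h =>
    not_sameCycle_mul_of_involutive hm hp hm' hp' x ((hr _ _).1 h)
  simp only [hm, not_lt]
  exact ⟨le_of_lt, fun h => lt_of_le_of_ne h hne.symm⟩

theorem two_mul_card_of_exchange {α : Type*} [Fintype α] {m : Perm α}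
    {A : α → Prop} [DecidablePred A] (hA : ∀ x, A (m x) ↔ ¬ A x) :
    2 * Fintype.card {x // A x} = Fintype.card α := by
  have h : Fintype.card {x // ¬ A x} = Fintype.card {x // A x} :=
    Fintype.card_congr (m.subtypeEquiv fun x => (hA x).symm)
  have := Fintype.card_subtype_compl A
  have := Fintype.card_subtype_le A
  omega

theorem cycleType_eq_two_nsmul_of_exchange {α : Type*} [Fintype α] [DecidableEq α] {m c : Perm α}
    (hc : m * c * m⁻¹ = c⁻¹) {A : α → Prop} [DecidablePred A]
    (hcA : ∀ x, A (c x) ↔ A x) (hA : ∀ x, A (m x) ↔ ¬ A x) :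
    c.cycleType = 2 • (c.subtypePerm hcA).cycleType := by
  set a := ofSubtype (c.subtypePerm hcA) with ha
  have hin (x : α) (hx : A x) : a x = c x := ofSubtype_subtypePerm_of_mem hcA hx
  have hout (x : α) (hx : ¬ A x) : a x = x := ofSubtype_apply_of_not_mem _ hx
  have hcm (x : α) : m (c (m⁻¹ x)) = c⁻¹ x := congrArg (fun g : Perm α => g x) hc
  have hAinv (x : α) : A (m⁻¹ x) ↔ ¬ A x := by
    have := hA (m⁻¹ x)
    rw [← mul_apply, mul_inv_cancel, one_apply] at this
    tauto
  have hin' (x : α) (hx : A x) : (m * a * m⁻¹)⁻¹ x = x := by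
    rw [inv_eq_iff_eq, mul_apply, mul_apply, hout _ (by rw [hAinv]; simpa using hx),
      ← mul_apply, mul_inv_cancel, one_apply]
  have hout' (x : α) (hx : ¬ A x) : (m * a * m⁻¹)⁻¹ x = c x := by
    rw [inv_eq_iff_eq, mul_apply, mul_apply,
      hin _ (by rwa [hAinv, hcA]), hcm, ← mul_apply, inv_mul_cancel, one_apply]
  have hdis : Disjoint a (m * a * m⁻¹)⁻¹ := fun x => by
    by_cases hx : A x
    · exact Or.inr (hin' x hx)
    · exact Or.inl (hout x hx)
  have hmul : c = a * (m * a * m⁻¹)⁻¹ := by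
    ext x
    by_cases hx : A x
    · rw [mul_apply, hin' x hx, hin x hx]
    · rw [mul_apply, hout' x hx, hout _ (by rwa [hcA])]
  conv_lhs => rw [hmul]
  rw [hdis.cycleType_mul, cycleType_inv, cycleType_conj, ha, cycleType_ofSubtype, two_nsmul]

theorem exists_equiv_semiconj_of_cycleType_eq {α β : Type*} [Fintype α] [DecidableEq α]
    [Fintype β] [DecidableEq β] {f : Perm α} {g : Perm β}
    (hcard : Fintype.card α = Fintype.card β) (h : f.cycleType = g.cycleType) :
    ∃ e : α ≃ β, ∀ x, e (f x) = g (e x) := by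
  let e := Fintype.equivOfCardEq hcard
  have he : (e.permCongr f).cycleType = g.cycleType := by
    let e' : α ≃ {y : β // True} := e.trans (Equiv.subtypeUnivEquiv fun _ => trivial).symm
    rw [← h, ← cycleType_extendDomain e' (g := f)]
    congr 1
  obtain ⟨s, hs⟩ := isConj_iff.1 (isConj_iff_cycleType_eq.2 he)
  refine ⟨e.trans s, fun x => ?_⟩
  rw [← hs]
  simp

/-- Two pairs of fixed-point-free involutions whose products have the same cycle type are
simultaneously conjugate. -/
theorem exists_simultaneous_conj {α : Type*} [Fintype α] [LinearOrder α] {m₁ p₁ m₂ p₂ : Perm α}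
    (hm₁ : ∀ x, m₁ (m₁ x) = x) (hp₁ : ∀ x, p₁ (p₁ x) = x)
    (hm₁' : ∀ x, m₁ x ≠ x) (hp₁' : ∀ x, p₁ x ≠ x)
    (hm₂ : ∀ x, m₂ (m₂ x) = x) (hp₂ : ∀ x, p₂ (p₂ x) = x)
    (hm₂' : ∀ x, m₂ x ≠ x) (hp₂' : ∀ x, p₂ x ≠ x)
    (h : (m₁ * p₁).cycleType = (m₂ * p₂).cycleType) :
    ∃ s : Perm α, s * m₁ * s⁻¹ = m₂ ∧ s * p₁ * s⁻¹ = p₂ := by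
  classical
  have hconj {m p : Perm α} (hm : ∀ x, m (m x) = x) (hp : ∀ x, p (p x) = x) :
      m * (m * p) * m⁻¹ = (m * p)⁻¹ := by
    have hpinv : p⁻¹ = p := by ext y; rw [inv_eq_iff_eq, hp]
    have hmm : m * m = 1 := by ext y; simp [hm]
    rw [mul_inv_rev, hpinv, ← mul_assoc m m p, hmm, one_mul]
  obtain ⟨A, hcA, hmA⟩ := exists_invariant_half hm₁ hp₁ hm₁' hp₁'
  obtain ⟨B, hcB, hmB⟩ := exists_invariant_half hm₂ hp₂ hm₂' hp₂'
  have hcard : Fintype.card {x // A x} = Fintype.card {x // B x} := by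
    have := two_mul_card_of_exchange hmA
    have := two_mul_card_of_exchange hmB
    omega
  have hct : ((m₁ * p₁).subtypePerm hcA).cycleType = ((m₂ * p₂).subtypePerm hcB).cycleType := by
    rw [cycleType_eq_two_nsmul_of_exchange (hconj hm₁ hp₁) hcA hmA,
      cycleType_eq_two_nsmul_of_exchange (hconj hm₂ hp₂) hcB hmB] at h
    exact nsmul_right_injective two_ne_zero h
  obtain ⟨e, he⟩ := exists_equiv_semiconj_of_cycleType_eq hcard hct
  have he' (x : α) (hx : A x) (hx' : A (m₁ (p₁ x))) :
      (e ⟨m₁ (p₁ x), hx'⟩ : α) = m₂ (p₂ (e ⟨x, hx⟩)) :=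
    congrArg Subtype.val (he ⟨x, hx⟩)
  let f : α → α := fun x =>
    if hx : A x then e ⟨x, hx⟩ else m₂ (e ⟨m₁ x, (hmA x).2 hx⟩)
  have hfpos (x : α) (hx : A x) : f x = e ⟨x, hx⟩ := dif_pos hx
  have hfneg (x : α) (hx : ¬ A x) : f x = m₂ (e ⟨m₁ x, (hmA x).2 hx⟩) := dif_neg hx
  have hfB (x : α) : B (f x) ↔ A x := by
    by_cases hx : A x
    · rw [hfpos x hx]
      exact iff_of_true (e _).2 hx
    · rw [hfneg x hx, hmB]
      exact iff_of_false (not_not.2 (e _).2) hx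
  have hinj : Function.Injective f := fun x y hxy => by
    have hAxy : A x ↔ A y := by rw [← hfB x, hxy, hfB y]
    by_cases hx : A x
    · rw [hfpos x hx, hfpos y (hAxy.1 hx)] at hxy
      exact congrArg Subtype.val (e.injective (Subtype.ext hxy))
    · rw [hfneg x hx, hfneg y (fun hy => hx (hAxy.2 hy))] at hxy
      exact m₁.injective
        (congrArg Subtype.val (e.injective (Subtype.ext (m₂.injective hxy))))
  have hfm (x : α) : f (m₁ x) = m₂ (f x) := by
    by_cases hx : A x
    · rw [hfneg _ (by rw [hmA]; exact not_not.2 hx), hfpos x hx]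
      simp only [hm₁]
    · rw [hfpos _ ((hmA x).2 hx), hfneg x hx, hm₂]
  have hfc (x : α) (hx : A x) : f (m₁ (p₁ x)) = m₂ (p₂ (f x)) := by
    have hx' : A (m₁ (p₁ x)) := (hcA x).2 hx
    rw [hfpos x hx, hfpos _ hx', he' x hx]
  have hpA (x : α) : A (p₁ x) ↔ ¬ A x := by
    have h1 := hcA x
    rw [mul_apply, hmA] at h1
    tauto
  have hfp (x : α) (hx : A x) : f (p₁ x) = p₂ (f x) := by
    apply m₂.injective
    rw [← hfm, hfc x hx]
  have hfp' (x : α) : f (p₁ x) = p₂ (f x) := by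
    by_cases hx : A x
    · exact hfp x hx
    · have := hfp (p₁ x) ((hpA x).2 hx)
      rw [hp₁] at this
      rw [this, hp₂]
  refine ⟨Equiv.ofBijective f (Finite.injective_iff_bijective.1 hinj), ?_, ?_⟩
  · rw [mul_inv_eq_iff_eq_mul]
    ext x
    exact hfm x
  · rw [mul_inv_eq_iff_eq_mul]
    ext x
    exact hfp' x

end Equiv.Perm

theorem IsPairMatching.conj_iff {N : ℕ} (s m : Equiv.Perm (Fin N)) :
    IsPairMatching m ↔ IsPairMatching (s * m * s⁻¹) := by
  unfold IsPairMatching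
  rw [← s.forall_congr_right (q := fun x => (s * m * s⁻¹) ((s * m * s⁻¹) x) = x),
    ← s.forall_congr_right (q := fun x => (s * m * s⁻¹) x ≠ x)]
  simp

/-- Conjugation by a permutation, acting on pair partitions. -/
def Matchings.conj {N : ℕ} (s : Equiv.Perm (Fin N)) : Matchings N ≃ Matchings N :=
  (MulAut.conj s).toEquiv.subtypeEquiv fun m => IsPairMatching.conj_iff s m

theorem cycleCount_conj_s15 {N : ℕ} (s c : Equiv.Perm (Fin N)) :
    cycleCount (s * c * s⁻¹) = cycleCount c := by
  unfold cycleCount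
  rw [Equiv.Perm.cycleType_conj]
  congr 1
  refine (Finset.card_bij (fun x _ => s x) ?_ (fun _ _ _ _ h => s.injective h) ?_).symm
  · intro x hx
    rw [Finset.mem_filter] at hx ⊢
    simpa using hx.2
  · intro y hy
    refine ⟨s⁻¹ y, ?_, by simp⟩
    rw [Finset.mem_filter] at hy ⊢
    refine ⟨Finset.mem_univ _, ?_⟩
    rw [Equiv.Perm.eq_inv_iff_eq]
    exact hy.2

theorem loopCount_conj {N : ℕ} (s : Equiv.Perm (Fin N)) (m p : Matchings N) :
    loopCount (Matchings.conj s m) (Matchings.conj s p) = loopCount m p := by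
  unfold loopCount
  rw [← cycleCount_conj_s15 s (m.1 * p.1)]
  congr 2
  change s * m.1 * s⁻¹ * (s * p.1 * s⁻¹) = _
  group

theorem GramO_submatrix_conj (d n : ℕ) (s : Equiv.Perm (Fin (2 * n))) :
    (GramO d n).submatrix (Matchings.conj s) (Matchings.conj s) = GramO d n := by
  ext m p
  simp [GramO, loopCount_conj]

theorem stmt15 (d n : ℕ) (hn : 0 < n) (hdn : d ≥ n)
    (m₁ p₁ m₂ p₂ : Matchings (2*n))
    (h : (m₁.1 * p₁.1).cycleType = (m₂.1 * p₂.1).cycleType) :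
    (GramO d n)⁻¹ m₁ p₁ = (GramO d n)⁻¹ m₂ p₂ := by
  obtain ⟨s, hsm, hsp⟩ := Equiv.Perm.exists_simultaneous_conj m₁.2.1 p₁.2.1 m₁.2.2 p₁.2.2
    m₂.2.1 p₂.2.1 m₂.2.2 p₂.2.2 (by convert h)
  have hm : Matchings.conj s m₁ = m₂ := Subtype.ext hsm
  have hp : Matchings.conj s p₁ = p₂ := Subtype.ext hsp
  rw [← hm, ← hp]
  conv_lhs => rw [← GramO_submatrix_conj d n s, Matrix.inv_submatrix_equiv]
  rfl
end
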